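/- For a Dirichlet distribution Dir(α) with C categories, α_0 = Σ_c α_c, ground-truth class c*, and γ > 0, the expected focal loss E_{p ~ Dir(α)}[-(1 - p_{c*})^γ log p_{c*}] equals [Γ(α_0) Γ(α_0 - α_{c*} + γ) / (Γ(α_0 + γ) Γ(α_0 - α_{c*}))] · [ψ(α_0 + γ) - ψ(α_{c*})]. -/

import Mathlib

open MeasureTheory Real BigOperators

/-- The digamma function `ψ = (log ∘ Γ)'`. -/
noncomputable def digamma (x : ℝ) : ℝ := deriv (fun y => Real.log (Real.Gamma y)) x

/-- The trigamma function `ψ₁ = ψ'`. -/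
noncomputable def trigamma (x : ℝ) : ℝ := deriv digamma x

/-- The multivariate Beta function `B(α) = (∏ᵢ Γ(αᵢ)) / Γ(∑ᵢ αᵢ)`. -/
noncomputable def mvBeta {C : ℕ} (α : Fin C → ℝ) : ℝ :=
  (∏ i, Real.Gamma (α i)) / Real.Gamma (∑ i, α i)

/-- The Dirichlet density `D(p | α) = (1 / B(α)) ∏ᵢ pᵢ^(αᵢ - 1)`. -/
noncomputable def dirichletDensity {C : ℕ} (α p : Fin C → ℝ) : ℝ :=
  (∏ i, p i ^ (α i - 1)) / mvBeta α

/-- Expectation `E_{p ~ Dir(α)}[g p]` for a Dirichlet distribution with `C + 1` categories,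
written as an integral over the first `C` coordinates (the last coordinate being
`1 - ∑` of the others), against the Dirichlet density on the simplex. -/
noncomputable def dirichletExp {C : ℕ} (α : Fin (C + 1) → ℝ) (g : (Fin (C + 1) → ℝ) → ℝ) : ℝ :=
  ∫ x : Fin C → ℝ,
    Set.indicator {x : Fin C → ℝ | (∀ i, 0 ≤ x i) ∧ ∑ i, x i ≤ 1}
      (fun x =>
        dirichletDensity α (Fin.snoc x (1 - ∑ i, x i)) *
          g (Fin.snoc x (1 - ∑ i, x i))) x

/-- Kullback–Leibler divergence `KL(Dir(α) ‖ Dir(α̂)) = E_{p ~ Dir(α)}[log (D(p|α)/D(p|α̂))]`. -/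
noncomputable def dirichletKL {C : ℕ} (α αhat : Fin (C + 1) → ℝ) : ℝ :=
  dirichletExp α (fun p => Real.log (dirichletDensity α p / dirichletDensity αhat p))

/-- Differential entropy `H(Dir(α)) = E_{p ~ Dir(α)}[- log D(p|α)]`. -/
noncomputable def dirichletEntropy {C : ℕ} (α : Fin (C + 1) → ℝ) : ℝ :=
  dirichletExp α (fun p => - Real.log (dirichletDensity α p))

open scoped ENNReal

/-- Tonelli's theorem on `ℝⁿ⁺¹`, singling out the coordinate `i`. -/
lemma lintegral_insertNth {n : ℕ} (i : Fin (n + 1)) {G : (Fin (n + 1) → ℝ) → ℝ≥0∞}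
    (hG : Measurable G) :
    ∫⁻ z, G z = ∫⁻ t : ℝ, ∫⁻ x : Fin n → ℝ, G (i.insertNth (α := fun _ => ℝ) t x) := by
  rw [((volume_preserving_piFinSuccAbove (fun _ : Fin (n + 1) => ℝ) i).symm
    (MeasurableEquiv.piFinSuccAbove (fun _ : Fin (n + 1) => ℝ) i)).lintegral_map_equiv G]
  have hm : Measurable fun p : ℝ × (Fin n → ℝ) =>
      G ((MeasurableEquiv.piFinSuccAbove (fun _ : Fin (n + 1) => ℝ) i).symm p) :=
    hG.comp (MeasurableEquiv.measurable _)
  exact lintegral_prod _ hm.aemeasurable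

/-- The point of the hyperplane `∑ i, p i = 1` with prescribed first `n` coordinates. -/
noncomputable def simplexPoint {n : ℕ} (x : Fin n → ℝ) : Fin (n + 1) → ℝ :=
  Fin.snoc (α := fun _ => ℝ) x (1 - ∑ i, x i)

lemma measurable_snoc_sub_sum {n : ℕ} :
    Measurable fun p : ℝ × (Fin n → ℝ) =>
      (Fin.snoc (α := fun _ => ℝ) p.2 (p.1 - ∑ i, p.2 i) : Fin (n + 1) → ℝ) := by
  refine measurable_pi_iff.2 fun i => ?_
  refine Fin.lastCases ?_ (fun j => ?_) i
  · simp only [Fin.snoc_last]; fun_prop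
  · simp only [Fin.snoc_castSucc]; fun_prop

lemma measurable_simplexPoint {n : ℕ} :
    Measurable (simplexPoint : (Fin n → ℝ) → Fin (n + 1) → ℝ) :=
  measurable_snoc_sub_sum.comp (measurable_const.prodMk measurable_id)

lemma sum_simplexPoint {n : ℕ} (x : Fin n → ℝ) : ∑ i, simplexPoint x i = 1 := by
  simp [simplexPoint, Fin.sum_univ_castSucc]

lemma lintegral_eq_lintegral_smul {n : ℕ} {s : ℝ} (hs : 0 < s) {F : (Fin n → ℝ) → ℝ≥0∞}
    (hF : Measurable F) :
    ∫⁻ y, F y = ENNReal.ofReal (s ^ (n : ℝ)) * ∫⁻ x, F (s • x) := by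
  have h := Measure.map_addHaar_smul (volume : Measure (Fin n → ℝ)) hs.ne'
  rw [← lintegral_map hF (measurable_const_smul s), h, lintegral_smul_measure, smul_eq_mul,
    ← mul_assoc, ← ENNReal.ofReal_mul (by positivity)]
  have : s ^ (n : ℝ) * |(s ^ Module.finrank ℝ (Fin n → ℝ))⁻¹| = 1 := by
    rw [abs_of_pos (by positivity), Module.finrank_fin_fun, rpow_natCast]
    field_simp
  rw [this]; simp

/-- Integration over `ℝⁿ⁺¹` of a homogeneous function times a function of the coordinate sum
splits as a product of a radial integral and an integral over the hyperplane `∑ i, p i = 1`. -/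
lemma lintegral_homogeneous_mul {n : ℕ} {H : (Fin (n + 1) → ℝ) → ℝ≥0∞} (hH : Measurable H)
    {φ : ℝ → ℝ≥0∞} (hφ : Measurable φ) (hφ0 : ∀ s ≤ 0, φ s = 0) {d : ℝ}
    (hd : ∀ s, 0 < s → ∀ z, H (s • z) = ENNReal.ofReal (s ^ d) * H z) :
    ∫⁻ z, H z * φ (∑ i, z i) =
      (∫⁻ s, ENNReal.ofReal (s ^ (d + n)) * φ s) * ∫⁻ x, H (simplexPoint x) := by
  have hsum : Measurable fun z : Fin (n + 1) → ℝ => ∑ i, z i := by fun_prop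
  have hm : Measurable fun p : ℝ × (Fin n → ℝ) =>
      H (Fin.snoc (α := fun _ => ℝ) p.2 (p.1 - ∑ i, p.2 i)) * φ p.1 :=
    (hH.comp measurable_snoc_sub_sum).mul (hφ.comp measurable_fst)
  have hm2 : Measurable fun p : ℝ × (Fin n → ℝ) =>
      H (Fin.snoc (α := fun _ => ℝ) p.2 p.1) * φ (∑ i, p.2 i + p.1) := by
    have : Measurable fun p : ℝ × (Fin n → ℝ) =>
        (Fin.snoc (α := fun _ => ℝ) p.2 p.1 : Fin (n + 1) → ℝ) := by
      convert measurable_snoc_sub_sum.comp (g := fun p : ℝ × (Fin n → ℝ) =>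
        (Fin.snoc (α := fun _ => ℝ) p.2 (p.1 - ∑ i, p.2 i) : Fin (n + 1) → ℝ))
        (f := fun p : ℝ × (Fin n → ℝ) => (p.1 + ∑ i, p.2 i, p.2)) (by fun_prop) using 2
      simp
    exact (hH.comp this).mul (hφ.comp (by fun_prop))
  calc ∫⁻ z, H z * φ (∑ i, z i)
      = ∫⁻ t : ℝ, ∫⁻ y : Fin n → ℝ,
          H (Fin.snoc (α := fun _ => ℝ) y t) * φ (∑ i, y i + t) := by
        rw [lintegral_insertNth (G := fun z => H z * φ (∑ i, z i)) (Fin.last n)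
          (hH.mul (hφ.comp hsum))]
        simp [Fin.insertNth_last', Fin.sum_univ_castSucc]
    _ = ∫⁻ y : Fin n → ℝ, ∫⁻ t : ℝ,
          H (Fin.snoc (α := fun _ => ℝ) y t) * φ (∑ i, y i + t) :=
        lintegral_lintegral_swap hm2.aemeasurable
    _ = ∫⁻ y : Fin n → ℝ, ∫⁻ s : ℝ,
          H (Fin.snoc (α := fun _ => ℝ) y (s - ∑ i, y i)) * φ s := by
        refine lintegral_congr fun y => ?_
        rw [← lintegral_sub_right_eq_self _ (∑ i, y i)]
        simp
    _ = ∫⁻ s : ℝ, ∫⁻ y : Fin n → ℝ,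
          H (Fin.snoc (α := fun _ => ℝ) y (s - ∑ i, y i)) * φ s :=
        (lintegral_lintegral_swap hm.aemeasurable).symm
    _ = ∫⁻ s : ℝ, (ENNReal.ofReal (s ^ (d + n)) * φ s) * ∫⁻ x, H (simplexPoint x) := by
        refine lintegral_congr fun s => ?_
        rcases le_or_gt s 0 with hs | hs
        · simp [hφ0 s hs]
        have hHs : Measurable fun y : Fin n → ℝ =>
            H (Fin.snoc (α := fun _ => ℝ) y (s - ∑ i, y i)) :=
          hH.comp (measurable_snoc_sub_sum.comp (measurable_const.prodMk measurable_id))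
        rw [lintegral_mul_const _ hHs, lintegral_eq_lintegral_smul hs hHs]
        have hpt : ∀ x : Fin n → ℝ,
            H (Fin.snoc (α := fun _ => ℝ) (s • x) (s - ∑ i, (s • x) i))
              = ENNReal.ofReal (s ^ d) * H (simplexPoint x) := by
          intro x
          rw [← hd s hs]
          congr 1
          ext i
          refine Fin.lastCases ?_ (fun j => ?_) i
          · simp [simplexPoint, Finset.mul_sum, mul_sub]
          · simp [simplexPoint]
        simp_rw [hpt]
        rw [lintegral_const_mul (f := fun x => H (simplexPoint x)) _
          (hH.comp measurable_simplexPoint), rpow_add hs,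
          ENNReal.ofReal_mul (by positivity)]
        ring
    _ = _ := by
        rw [lintegral_mul_const]
        exact (by fun_prop : Measurable fun s : ℝ => ENNReal.ofReal (s ^ (d + n))).mul hφ

/-- The function `t ↦ t ^ (a - 1)` on `(0, ∞)`, extended by zero. -/
noncomputable def posPow (a t : ℝ) : ℝ≥0∞ :=
  (Set.Ioi 0).indicator (fun t => ENNReal.ofReal (t ^ (a - 1))) t

@[fun_prop]
lemma measurable_posPow (a : ℝ) : Measurable (posPow a) :=
  Measurable.indicator (by fun_prop) measurableSet_Ioi

lemma posPow_of_pos {t : ℝ} (a : ℝ) (ht : 0 < t) :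
    posPow a t = ENNReal.ofReal (t ^ (a - 1)) := by
  simp [posPow, ht]

lemma posPow_of_nonpos {t : ℝ} (a : ℝ) (ht : t ≤ 0) : posPow a t = 0 := by
  simp [posPow, ht]

lemma posPow_mul {s : ℝ} (hs : 0 < s) (a t : ℝ) :
    posPow a (s * t) = ENNReal.ofReal (s ^ (a - 1)) * posPow a t := by
  rcases le_or_gt t 0 with ht | ht
  · rw [posPow_of_nonpos _ ht, posPow_of_nonpos _ (by nlinarith), mul_zero]
  · rw [posPow_of_pos _ ht, posPow_of_pos _ (by positivity), mul_rpow hs.le ht.le,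
      ENNReal.ofReal_mul (by positivity)]

lemma ofReal_rpow_mul_posPow (a b t : ℝ) :
    ENNReal.ofReal (t ^ b) * posPow a t = posPow (b + a) t := by
  rcases le_or_gt t 0 with ht | ht
  · simp [posPow_of_nonpos _ ht]
  · rw [posPow_of_pos _ ht, posPow_of_pos _ ht, ← ENNReal.ofReal_mul (by positivity),
      ← rpow_add ht, add_sub_assoc]

lemma lintegral_posPow_mul_exp {a : ℝ} (ha : 0 < a) :
    ∫⁻ t, posPow a t * ENNReal.ofReal (exp (-t)) = ENNReal.ofReal (Gamma a) := by
  have hnn : ∀ t ∈ Set.Ioi (0 : ℝ), 0 ≤ exp (-t) * t ^ (a - 1) := fun t ht => by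
    have : 0 < t := ht
    positivity
  rw [Gamma_eq_integral ha, ofReal_integral_eq_lintegral_ofReal (GammaIntegral_convergent ha)
    ((ae_restrict_iff' measurableSet_Ioi).2 (.of_forall hnn)),
    ← lintegral_indicator measurableSet_Ioi]
  refine lintegral_congr fun t => ?_
  by_cases ht : 0 < t
  · simp [posPow, ht, ENNReal.ofReal_mul (exp_pos _).le, mul_comm (ENNReal.ofReal (t ^ (a - 1)))]
  · simp [posPow, ht]

/-- The integral of a product of functions of the individual coordinates. -/
lemma lintegral_pi_prod {n : ℕ} {f : Fin n → ℝ → ℝ≥0∞} (hf : ∀ i, Measurable (f i)) :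
    ∫⁻ z : Fin n → ℝ, ∏ i, f i (z i) = ∏ i, ∫⁻ t, f i t := by
  induction n with
  | zero => simp [lintegral_unique, volume_pi]
  | succ n ih =>
    rw [lintegral_insertNth 0 (by fun_prop), Fin.prod_univ_succ, ← ih fun i => hf i.succ,
      ← lintegral_mul_const _ (hf 0)]
    refine lintegral_congr fun t => ?_
    rw [← lintegral_const_mul _ (by fun_prop)]
    simp [Fin.prod_univ_succ]

lemma prod_posPow_smul {n : ℕ} (β : Fin n → ℝ) {s : ℝ} (hs : 0 < s) (z : Fin n → ℝ) :
    ∏ i, posPow (β i) ((s • z) i) =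
      ENNReal.ofReal (s ^ (∑ i, β i - n)) * ∏ i, posPow (β i) (z i) := by
  simp only [Pi.smul_apply, smul_eq_mul, posPow_mul hs, Finset.prod_mul_distrib]
  rw [← ENNReal.ofReal_prod_of_nonneg fun i _ => by positivity, ← rpow_sum_of_pos hs]
  simp

lemma ofReal_exp_neg_sum {n : ℕ} (z : Fin n → ℝ) :
    ENNReal.ofReal (exp (-∑ i, z i)) = ∏ i, ENNReal.ofReal (exp (-z i)) := by
  rw [← Finset.sum_neg_distrib, exp_sum, ENNReal.ofReal_prod_of_nonneg fun i _ => by positivity]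

lemma prod_posPow_mul_posPow_one {n : ℕ} (β z : Fin (n + 1) → ℝ) :
    (∏ i, posPow (β i) (z i)) * posPow 1 (∑ i, z i) = ∏ i, posPow (β i) (z i) := by
  by_cases h : ∀ i, 0 < z i
  · rw [posPow_of_pos 1 (Finset.sum_pos (fun i _ => h i) Finset.univ_nonempty)]
    simp
  · push Not at h
    obtain ⟨i, hi⟩ := h
    rw [Finset.prod_eq_zero (Finset.mem_univ i) (posPow_of_nonpos _ hi), zero_mul]

lemma ae_simplexPoint_ne_zero {n : ℕ} :
    ∀ᵐ x : Fin n → ℝ, ∀ i, simplexPoint x i ≠ 0 := by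
  refine ae_all_iff.2 fun i => ?_
  have hS : MeasurableSet {z : Fin (n + 1) → ℝ | z i = 0} :=
    measurableSet_eq_fun (measurable_pi_apply i) measurable_const
  have hH : Measurable ({z : Fin (n + 1) → ℝ | z i = 0}.indicator (1 : (Fin (n + 1) → ℝ) → ℝ≥0∞)) :=
    measurable_one.indicator hS
  have key := lintegral_homogeneous_mul hH
    (φ := fun s => posPow 1 s * ENNReal.ofReal (exp (-s))) (by fun_prop)
    (fun s hs => by simp [posPow_of_nonpos _ hs]) (d := 0)
    (fun s hs z => by simp [Set.indicator_apply, hs.ne'])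
  have h0 : ∫⁻ z : Fin (n + 1) → ℝ, ({z : Fin (n + 1) → ℝ | z i = 0}.indicator (1 : (Fin (n + 1) → ℝ) → ℝ≥0∞)) z *
      (posPow 1 (∑ i, z i) * ENNReal.ofReal (exp (-∑ i, z i))) = 0 := by
    have hz : volume {z : Fin (n + 1) → ℝ | z i = 0} = 0 :=
      Measure.pi_hyperplane (fun _ => volume) i 0
    rw [← lintegral_zero (μ := (volume : Measure (Fin (n + 1) → ℝ)))]
    refine lintegral_congr_ae ?_
    filter_upwards [measure_eq_zero_iff_ae_notMem.1 hz] with z hz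
    exact mul_eq_zero_of_left
      (Set.indicator_of_notMem (s := {z : Fin (n + 1) → ℝ | z i = 0}) hz _) _
  have h1 : ∫⁻ s : ℝ, ENNReal.ofReal (s ^ ((0 : ℝ) + n)) *
      (posPow 1 s * ENNReal.ofReal (exp (-s))) ≠ 0 := by
    simp_rw [← mul_assoc, ofReal_rpow_mul_posPow]
    rw [lintegral_posPow_mul_exp (by positivity), ENNReal.ofReal_ne_zero_iff]
    exact Gamma_pos_of_pos (by positivity)
  rw [h0, eq_comm, mul_eq_zero, or_iff_right h1,
    lintegral_eq_zero_iff (f := fun x => Set.indicator _ _ (simplexPoint x)) (hH.comp measurable_simplexPoint)] at key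
  filter_upwards [key] with x hx hxi
  simp [hxi] at hx

/-- The unnormalised Dirichlet integral against a power of the coordinate sum. -/
lemma lintegral_prod_posPow_mul {n : ℕ} (β : Fin (n + 1) → ℝ) {γ : ℝ} (h : 0 < ∑ i, β i + γ) :
    ∫⁻ z : Fin (n + 1) → ℝ, (∏ i, posPow (β i) (z i)) *
        (posPow (γ + 1) (∑ i, z i) * ENNReal.ofReal (exp (-∑ i, z i))) =
      ENNReal.ofReal (Gamma (∑ i, β i + γ)) *
        ∫⁻ x, ∏ i, posPow (β i) (simplexPoint x i) := by
  rw [lintegral_homogeneous_mul (H := fun z : Fin (n + 1) → ℝ => ∏ i, posPow (β i) (z i))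
    (by fun_prop) (φ := fun s => posPow (γ + 1) s * ENNReal.ofReal (exp (-s))) (by fun_prop)
    (fun s hs => by simp [posPow_of_nonpos _ hs]) (fun s hs z => prod_posPow_smul β hs z)]
  congr 1
  simp_rw [← mul_assoc, ofReal_rpow_mul_posPow]
  rw [← lintegral_posPow_mul_exp h]
  congr! 4
  push_cast; ring

lemma lintegral_prod_posPow_simplexPoint {n : ℕ} {β : Fin (n + 1) → ℝ} (hβ : ∀ i, 0 < β i) :
    ∫⁻ x, ∏ i, posPow (β i) (simplexPoint x i) = ENNReal.ofReal (mvBeta β) := by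
  have hs : 0 < ∑ i, β i := Finset.sum_pos (fun i _ => hβ i) Finset.univ_nonempty
  have h := lintegral_prod_posPow_mul β (γ := 0) (by simpa using hs)
  simp_rw [zero_add, ← mul_assoc, prod_posPow_mul_posPow_one, ofReal_exp_neg_sum,
    ← Finset.prod_mul_distrib, add_zero] at h
  rw [lintegral_pi_prod (f := fun i t => posPow (β i) t * ENNReal.ofReal (exp (-t)))
    (by fun_prop)] at h
  simp_rw [lintegral_posPow_mul_exp (hβ _)] at h
  rw [← ENNReal.ofReal_prod_of_nonneg fun i _ => (Gamma_pos_of_pos (hβ i)).le] at h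
  have hG := Gamma_pos_of_pos hs
  rw [mvBeta, ENNReal.ofReal_div_of_pos hG, h, mul_comm, ENNReal.mul_div_cancel_right]
  · simpa using hG
  · simp

/-- The Dirichlet weight with exponent `a` at the coordinate `i` and exponents `β` at the others,
multiplied by the `γ`-th power of the sum of the coordinates other than `i`. -/
noncomputable def focalWeight {n : ℕ} (i : Fin (n + 2)) (β : Fin (n + 1) → ℝ) (γ a : ℝ)
    (z : Fin (n + 2) → ℝ) : ℝ≥0∞ :=
  posPow a (z i) * ((∏ j, posPow (β j) (z (i.succAbove j))) *
    posPow (γ + 1) (∑ j, z (i.succAbove j)))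

lemma measurable_focalWeight {n : ℕ} (i : Fin (n + 2)) (β : Fin (n + 1) → ℝ) (γ a : ℝ) :
    Measurable (focalWeight i β γ a) := by
  unfold focalWeight; fun_prop

lemma focalWeight_smul {n : ℕ} (i : Fin (n + 2)) (β : Fin (n + 1) → ℝ) (γ a : ℝ) {s : ℝ}
    (hs : 0 < s) (z : Fin (n + 2) → ℝ) :
    focalWeight i β γ a (s • z) =
      ENNReal.ofReal (s ^ (a - 1 + ((∑ j, β j - (n + 1 : ℕ)) + γ))) * focalWeight i β γ a z := by
  have h := prod_posPow_smul β hs fun j => z (i.succAbove j)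
  simp only [Pi.smul_apply, smul_eq_mul] at h
  simp only [focalWeight, Pi.smul_apply, smul_eq_mul, ← Finset.mul_sum]
  rw [h, posPow_mul hs, posPow_mul hs]
  rw [rpow_add hs, rpow_add hs (_ - _) γ, ENNReal.ofReal_mul (by positivity),
    ENNReal.ofReal_mul (by positivity), add_sub_cancel_right]
  ring

lemma focalWeight_mul_posPow_one {n : ℕ} (i : Fin (n + 2)) (β : Fin (n + 1) → ℝ) (γ a : ℝ)
    (z : Fin (n + 2) → ℝ) :
    focalWeight i β γ a z * posPow 1 (∑ j, z j) = focalWeight i β γ a z := by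
  rcases le_or_gt (z i) 0 with h | h
  · simp [focalWeight, posPow_of_nonpos _ h]
  rcases le_or_gt (∑ j, z (i.succAbove j)) 0 with h' | h'
  · simp [focalWeight, posPow_of_nonpos _ h']
  rw [posPow_of_pos 1 (by rw [Fin.sum_univ_succAbove _ i]; positivity)]
  simp

lemma lintegral_focalWeight {n : ℕ} (i : Fin (n + 2)) {β : Fin (n + 1) → ℝ} (hβ : ∀ j, 0 < β j)
    {γ a : ℝ} (hγ : 0 < γ) (ha : 0 < a) :
    ∫⁻ x, focalWeight i β γ a (simplexPoint x) =
      ENNReal.ofReal (Gamma (∑ j, β j + γ) * mvBeta β * (Gamma a / Gamma (a + ∑ j, β j + γ))) := by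
  have hs : 0 < ∑ j, β j := Finset.sum_pos (fun i _ => hβ i) Finset.univ_nonempty
  have key := lintegral_homogeneous_mul (measurable_focalWeight i β γ a)
    (φ := fun s => posPow 1 s * ENNReal.ofReal (exp (-s))) (by fun_prop)
    (fun s hs => by simp [posPow_of_nonpos _ hs]) (fun s hs z => focalWeight_smul i β γ a hs z)
  simp_rw [← mul_assoc, ofReal_rpow_mul_posPow, focalWeight_mul_posPow_one] at key
  have hm := measurable_focalWeight i β γ a
  have hexp : a - 1 + (∑ j, β j - ((n + 1 : ℕ) : ℝ) + γ) + ((n + 1 : ℕ) : ℝ) + 1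
      = a + ∑ j, β j + γ := by ring
  rw [hexp, lintegral_posPow_mul_exp (by positivity), lintegral_insertNth i (by fun_prop)] at key
  have hin : ∀ t : ℝ, ∫⁻ x : Fin (n + 1) → ℝ,
      focalWeight i β γ a (i.insertNth (α := fun _ => ℝ) t x) *
        ENNReal.ofReal (exp (-∑ j, i.insertNth (α := fun _ => ℝ) t x j)) =
      posPow a t * ENNReal.ofReal (exp (-t)) *
        (ENNReal.ofReal (Gamma (∑ j, β j + γ)) * ENNReal.ofReal (mvBeta β)) := by
    intro t
    rw [← lintegral_prod_posPow_simplexPoint hβ, ← lintegral_prod_posPow_mul β (by positivity),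
      ← lintegral_const_mul _ (by fun_prop)]
    refine lintegral_congr fun x => ?_
    simp only [focalWeight, Fin.sum_univ_succAbove _ i, Fin.insertNth_apply_same,
      Fin.insertNth_apply_succAbove, neg_add, exp_add]
    rw [ENNReal.ofReal_mul (exp_pos _).le]
    ring
  simp_rw [hin] at key
  rw [lintegral_mul_const _ (by fun_prop), lintegral_posPow_mul_exp ha] at key
  have hG : 0 < Gamma (a + ∑ j, β j + γ) := Gamma_pos_of_pos (by positivity)
  have hB : 0 ≤ mvBeta β :=
    div_nonneg (Finset.prod_nonneg fun i _ => (Gamma_pos_of_pos (hβ i)).le) (Gamma_pos_of_pos hs).le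
  have hG' : 0 < Gamma (∑ j, β j + γ) := Gamma_pos_of_pos (by positivity)
  rw [← mul_div_assoc, ENNReal.ofReal_div_of_pos hG, ENNReal.ofReal_mul (by positivity),
    ENNReal.ofReal_mul hG'.le, mul_comm _ (ENNReal.ofReal (Gamma a)), key, mul_comm,
    ENNReal.mul_div_cancel_right (by simpa using hG) (by simp)]

lemma focalWeight_mul_exp_log {n : ℕ} (i : Fin (n + 2)) (β : Fin (n + 1) → ℝ) (γ a s : ℝ)
    (z : Fin (n + 2) → ℝ) :
    focalWeight i β γ a z * ENNReal.ofReal (exp (s * log (z i))) =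
      focalWeight i β γ (a + s) z := by
  rcases le_or_gt (z i) 0 with h | h
  · simp [focalWeight, posPow_of_nonpos _ h]
  · rw [mul_comm s, ← rpow_def_of_pos h, mul_comm, focalWeight, ← mul_assoc,
      ofReal_rpow_mul_posPow, add_comm, focalWeight]

lemma hasDerivAt_Gamma_of_pos {x : ℝ} (hx : 0 < x) :
    HasDerivAt Gamma (Gamma x * digamma x) x := by
  have hd : DifferentiableAt ℝ Gamma x :=
    differentiableAt_Gamma fun m h => by
      have : (0 : ℝ) ≤ m := m.cast_nonneg
      linarith
  have hG := (Gamma_pos_of_pos hx).ne'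
  have h : digamma x = deriv Gamma x / Gamma x := (hd.hasDerivAt.log hG).deriv
  rw [h, mul_div_cancel₀ _ hG]
  exact hd.hasDerivAt

/-- `∂/∂a` of `Γ(a) / Γ(a + c)`. -/
lemma hasDerivAt_Gamma_div_Gamma {a c : ℝ} (ha : 0 < a) (hc : 0 < a + c) :
    HasDerivAt (fun s => Gamma (a + s) / Gamma (a + s + c))
      (Gamma a / Gamma (a + c) * (digamma a - digamma (a + c))) 0 := by
  have h1 : HasDerivAt (fun s => Gamma (a + s)) (Gamma a * digamma a) 0 := by
    apply HasDerivAt.comp_const_add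
    simpa using hasDerivAt_Gamma_of_pos ha
  have h2 : HasDerivAt (fun s => Gamma (a + s + c)) (Gamma (a + c) * digamma (a + c)) 0 := by
    simp_rw [add_right_comm a _ c]
    apply HasDerivAt.comp_const_add
    simpa using hasDerivAt_Gamma_of_pos hc
  have hG := (Gamma_pos_of_pos hc).ne'
  refine (h1.fun_div h2 (by simpa using hG)).congr_deriv ?_
  rw [add_zero]
  field_simp

open ProbabilityTheory in
/-- The integral of `log p_i` against the focal weight, by differentiating the moment generating
function of `log p_i` at zero. -/
lemma integral_focalWeight_mul_log {n : ℕ} (i : Fin (n + 2)) {β : Fin (n + 1) → ℝ}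
    (hβ : ∀ j, 0 < β j) {γ a : ℝ} (hγ : 0 < γ) (ha : 0 < a) :
    ∫ x, (focalWeight i β γ a (simplexPoint x)).toReal * log (simplexPoint x i) =
      Gamma (∑ j, β j + γ) * mvBeta β * (Gamma a / Gamma (a + (∑ j, β j + γ)) *
        (digamma a - digamma (a + (∑ j, β j + γ)))) := by
  have hs : 0 < ∑ j, β j := Finset.sum_pos (fun i _ => hβ i) Finset.univ_nonempty
  have hB : 0 ≤ mvBeta β :=
    div_nonneg (Finset.prod_nonneg fun i _ => (Gamma_pos_of_pos (hβ i)).le) (Gamma_pos_of_pos hs).le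
  have hG' : 0 < Gamma (∑ j, β j + γ) := Gamma_pos_of_pos (by positivity)
  have hW : Measurable fun x : Fin (n + 1) → ℝ => focalWeight i β γ a (simplexPoint x) :=
    (measurable_focalWeight i β γ a).comp measurable_simplexPoint
  have hX : Measurable fun x : Fin (n + 1) → ℝ => log (simplexPoint x i) :=
    measurable_log.comp ((measurable_pi_apply i).comp measurable_simplexPoint)
  set X := fun x : Fin (n + 1) → ℝ => log (simplexPoint x i) with hXdef
  set μ : Measure (Fin (n + 1) → ℝ) :=
    volume.withDensity fun x => focalWeight i β γ a (simplexPoint x) with hμ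
  have hlint : ∀ s, -a < s → ∫⁻ x, ENNReal.ofReal (exp (s * X x)) ∂μ =
      ENNReal.ofReal (Gamma (∑ j, β j + γ) * mvBeta β *
        (Gamma (a + s) / Gamma (a + s + (∑ j, β j + γ)))) := by
    intro s h
    rw [lintegral_withDensity_eq_lintegral_mul _ hW (by fun_prop), ← add_assoc,
      ← lintegral_focalWeight i hβ hγ (by linarith)]
    exact lintegral_congr fun x => focalWeight_mul_exp_log i β γ a s _
  have hint : ∀ s, -a < s → Integrable (fun x => exp (s * X x)) μ := by
    intro s h
    refine (lintegral_ofReal_ne_top_iff_integrable (by fun_prop)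
      (.of_forall fun x => (exp_pos _).le)).1 ?_
    rw [hlint s h]
    exact ENNReal.ofReal_ne_top
  have hmgf : ∀ s, -a < s → mgf X μ s = Gamma (∑ j, β j + γ) * mvBeta β *
        (Gamma (a + s) / Gamma (a + s + (∑ j, β j + γ))) := by
    intro s h
    rw [mgf, integral_eq_lintegral_of_nonneg_ae (.of_forall fun x => (exp_pos _).le)
      (by fun_prop), hlint s h, ENNReal.toReal_ofReal]
    have h1 := Gamma_pos_of_pos (show 0 < a + s by linarith)
    have h2 := Gamma_pos_of_pos (show 0 < a + s + (∑ j, β j + γ) by linarith)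
    positivity
  have hnhds : Set.Ioi (-a) ∈ nhds (0 : ℝ) := Ioi_mem_nhds (by linarith)
  have h0 : (0 : ℝ) ∈ interior (integrableExpSet X μ) :=
    mem_interior_iff_mem_nhds.2 (Filter.mem_of_superset hnhds hint)
  have hd1 := hasDerivAt_mgf h0
  have hd2 : HasDerivAt (mgf X μ) _ 0 :=
    ((hasDerivAt_Gamma_div_Gamma (c := ∑ j, β j + γ) ha (by positivity)).const_mul
      (Gamma (∑ j, β j + γ) * mvBeta β)).congr_of_eventuallyEq
      (Filter.eventually_of_mem hnhds hmgf)
  rw [← hd1.unique hd2, integral_withDensity_eq_integral_toReal_smul hW]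
  · simp [hXdef, mul_comm]
  · refine .of_forall fun x => ?_
    refine ENNReal.mul_lt_top ?_ (ENNReal.mul_lt_top (ENNReal.prod_lt_top fun j _ => ?_) ?_) <;>
    · unfold posPow
      rw [Set.indicator_apply]
      split_ifs <;> simp

lemma forall_nonneg_simplexPoint_iff {n : ℕ} (x : Fin n → ℝ) :
    (∀ i, 0 ≤ simplexPoint x i) ↔ x ∈ {x : Fin n → ℝ | (∀ i, 0 ≤ x i) ∧ ∑ i, x i ≤ 1} := by
  simp [Fin.forall_fin_succ', simplexPoint]

lemma toReal_focalWeight_of_pos {n : ℕ} (i : Fin (n + 2)) (β : Fin (n + 1) → ℝ) (γ a : ℝ)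
    {z : Fin (n + 2) → ℝ} (hz : ∀ j, 0 < z j) :
    (focalWeight i β γ a z).toReal = z i ^ (a - 1) *
      ((∏ j, z (i.succAbove j) ^ (β j - 1)) * (∑ j, z (i.succAbove j)) ^ γ) := by
  have hs : 0 < ∑ j, z (i.succAbove j) := Finset.sum_pos (fun j _ => hz _) Finset.univ_nonempty
  simp only [focalWeight, posPow_of_pos _ (hz _), posPow_of_pos _ hs, ENNReal.toReal_mul,
    ENNReal.toReal_prod, add_sub_cancel_right]
  have h : ∀ (j : Fin (n + 2)) (b : ℝ), 0 ≤ z j ^ b := fun j b => rpow_nonneg (hz j).le b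
  simp only [ENNReal.toReal_ofReal (h _ _), ENNReal.toReal_ofReal (rpow_nonneg hs.le γ)]

lemma focalWeight_of_neg {n : ℕ} (i : Fin (n + 2)) (β : Fin (n + 1) → ℝ) (γ a : ℝ)
    {z : Fin (n + 2) → ℝ} {j : Fin (n + 2)} (hj : z j < 0) : focalWeight i β γ a z = 0 := by
  rcases Fin.eq_self_or_eq_succAbove i j with rfl | ⟨k, rfl⟩
  · simp [focalWeight, posPow_of_nonpos _ hj.le]
  · rw [focalWeight, Finset.prod_eq_zero (Finset.mem_univ k) (posPow_of_nonpos _ hj.le)]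
    simp

/-- The expected focal loss under a Dirichlet distribution:
`E_{p ~ Dir(α)}[-(1 - p_{c*})^γ log p_{c*}]
  = (Γ(α₀)Γ(α₀ - α_{c*} + γ) / (Γ(α₀+γ)Γ(α₀ - α_{c*}))) (ψ(α₀+γ) - ψ(α_{c*}))`. -/
theorem expected_focal_loss_dirichlet
    (C : ℕ) (α : Fin (C + 1) → ℝ) (hα : ∀ i, 0 < α i)
    (cstar : Fin (C + 1)) (γ : ℝ) (hγ : 0 < γ)
    (hlt : α cstar < ∑ i, α i) :
    dirichletExp α (fun p => -(1 - p cstar) ^ γ * Real.log (p cstar)) =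
      (Real.Gamma (∑ i, α i) * Real.Gamma ((∑ i, α i) - α cstar + γ) /
          (Real.Gamma ((∑ i, α i) + γ) * Real.Gamma ((∑ i, α i) - α cstar))) *
        (digamma ((∑ i, α i) + γ) - digamma (α cstar)) := by
  obtain _ | n := C
  · simp [Fin.fin_one_eq_zero cstar] at hlt
  set β : Fin (n + 1) → ℝ := fun j => α (cstar.succAbove j) with hβdef
  have hβ : ∀ j, 0 < β j := fun j => hα _
  have hs : 0 < ∑ j, β j := Finset.sum_pos (fun i _ => hβ i) Finset.univ_nonempty
  have hsum : ∑ i, α i = α cstar + ∑ j, β j := Fin.sum_univ_succAbove _ cstar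
  have hexp : dirichletExp α (fun p => -(1 - p cstar) ^ γ * Real.log (p cstar)) =
      ∫ x, -(mvBeta α)⁻¹ * ((focalWeight cstar β γ (α cstar) (simplexPoint x)).toReal *
        log (simplexPoint x cstar)) := by
    refine integral_congr_ae ?_
    filter_upwards [ae_simplexPoint_ne_zero] with x hx
    by_cases h : ∀ i, 0 ≤ simplexPoint x i
    · rw [Set.indicator_of_mem ((forall_nonneg_simplexPoint_iff x).1 h)]
      have hpos : ∀ j, 0 < simplexPoint x j := fun j => (h j).lt_of_ne (hx j).symm
      have h1 : 1 - simplexPoint x cstar = ∑ j, simplexPoint x (cstar.succAbove j) := by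
        rw [← sum_simplexPoint x, Fin.sum_univ_succAbove _ cstar, add_sub_cancel_left]
      rw [toReal_focalWeight_of_pos _ _ _ _ hpos, ← h1]
      change dirichletDensity α (simplexPoint x) * (-(1 - simplexPoint x cstar) ^ γ *
        log (simplexPoint x cstar)) = _
      rw [dirichletDensity, Fin.prod_univ_succAbove _ cstar]
      ring
    · rw [Set.indicator_of_notMem fun h' => h ((forall_nonneg_simplexPoint_iff x).2 h')]
      push Not at h
      obtain ⟨j, hj⟩ := h
      simp [focalWeight_of_neg _ _ _ _ hj]
  rw [hexp, integral_const_mul, integral_focalWeight_mul_log cstar hβ hγ (hα cstar), mvBeta, mvBeta,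
    Fin.prod_univ_succAbove _ cstar, hsum, add_sub_cancel_left, ← add_assoc]
  have h1 := (Gamma_pos_of_pos (hα cstar)).ne'
  have h2 := (Gamma_pos_of_pos hs).ne'
  have h3 := (Gamma_pos_of_pos (add_pos (hα cstar) hs)).ne'
  have h4 := (Gamma_pos_of_pos (add_pos (add_pos (hα cstar) hs) hγ)).ne'
  have h5 : ∏ j, Gamma (β j) ≠ 0 :=
    Finset.prod_ne_zero_iff.2 fun j _ => (Gamma_pos_of_pos (hβ j)).ne'
  change -((Gamma (α cstar) * ∏ j, Gamma (β j)) / _)⁻¹ * _ = _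
  field_simp
  ring
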